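/- Let A ⊆ ℕ have upper fractional density α with α > 1/2, and suppose there exist a constant C > 0, a real β with 2/3 < β ≤ 1 and β > 2 − 2α, and N0 ∈ ℕ such that for all N ≥ N0 and all integers k with 1 ≤ k ≤ N − 1, |χ̂_{A_N}(k)| ≤ C·(kN)^{−β/2}. Then A contains a non-trivial arithmetic progression of length 3, i.e. there exist a ∈ ℕ and d ≥ 1 with a, a+d, a+2d ∈ A. -/

import Mathlib

open MeasureTheory Filter Set
open scoped BigOperators ENNReal

/-- Number of elements of `A ⊆ ℕ` below `n`, i.e. `|A ∩ [0, n)|`. -/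
noncomputable def cardBelow (A : Set ℕ) (n : ℕ) : ℕ := Nat.card ↥(A ∩ Set.Iio n)

/-- `A ⊆ ℕ` has upper fractional density `α`: `limsup_N |A ∩ [0,N)| / N^b` is `∞` for
every `b < α` and `0` for every `b > α`. -/
def HasUpperFracDensity (A : Set ℕ) (α : ℝ) : Prop :=
  (∀ b : ℝ, b < α →
    Filter.atTop.limsup (fun n : ℕ => (cardBelow A n : ℝ≥0∞) / (n : ℝ≥0∞) ^ b) = ⊤) ∧
  (∀ b : ℝ, α < b →
    Filter.atTop.limsup (fun n : ℕ => (cardBelow A n : ℝ≥0∞) / (n : ℝ≥0∞) ^ b) = 0)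

open Classical in
/-- The discrete Fourier transform of the characteristic function of `A ∩ [0,N)`,
regarded as a function on the cyclic group `ℤ/N`:
`χ̂_{A_N}(k) = (1/N) Σ_{n=0}^{N−1} χ_A(n) e^{−2πikn/N}`. -/
noncomputable def dft (A : Set ℕ) (N k : ℕ) : ℂ :=
  (N : ℂ)⁻¹ * ∑ n ∈ Finset.range N,
    (if n ∈ A then Complex.exp ((-2) * (Real.pi : ℂ) * Complex.I * (k : ℂ) * (n : ℂ) / (N : ℂ))
     else 0)

/-- **Parseval's identity** for the exponential sum of a set of residues modulo `N`. -/
lemma sum_sq_norm_exp_sum {N : ℕ} (hN : 0 < N) (S : Finset ℕ) (hS : S ⊆ Finset.range N) :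
    ∑ k ∈ Finset.range N, ‖∑ n ∈ S,
      Complex.exp ((-2) * (Real.pi : ℂ) * Complex.I * (k : ℂ) * (n : ℂ) / (N : ℂ))‖ ^ 2
      = (N : ℝ) * (S.card : ℝ) := by
  have hNC : (N : ℂ) ≠ 0 := by exact_mod_cast hN.ne'
  set w : ℕ → ℕ → ℂ := fun n m =>
    Complex.exp (2 * (Real.pi : ℂ) * Complex.I * (((m : ℂ) - n) / N)) with hw
  have hterm : ∀ k n m : ℕ,
      Complex.exp ((-2) * (Real.pi : ℂ) * Complex.I * (k : ℂ) * (n : ℂ) / (N : ℂ)) *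
        (starRingEnd ℂ)
          (Complex.exp ((-2) * (Real.pi : ℂ) * Complex.I * (k : ℂ) * (m : ℂ) / (N : ℂ)))
        = w n m ^ k := by
    intro k n m
    rw [← Complex.exp_conj, ← Complex.exp_add, hw, ← Complex.exp_nat_mul]
    congr 1
    simp only [map_div₀, map_mul, map_neg, Complex.conj_ofReal, Complex.conj_I, map_natCast,
      map_ofNat]
    field_simp
    ring
  have hgeom : ∀ n ∈ S, ∀ m ∈ S,
      ∑ k ∈ Finset.range N, w n m ^ k = if n = m then (N : ℂ) else 0 := by
    intro n hn m hm
    have hn' := Finset.mem_range.1 (hS hn)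
    have hm' := Finset.mem_range.1 (hS hm)
    split_ifs with h
    · subst h
      simp [hw]
    · have hpow : w n m ^ N = 1 := by
        rw [hw, ← Complex.exp_nat_mul, Complex.exp_eq_one_iff]
        refine ⟨(m : ℤ) - n, ?_⟩
        push_cast
        field_simp
      have hne : w n m ≠ 1 := by
        intro h1
        obtain ⟨t, ht⟩ := Complex.exp_eq_one_iff.1 h1
        have hpi : (2 * (Real.pi : ℂ) * Complex.I) ≠ 0 := Complex.two_pi_I_ne_zero
        rw [mul_comm (t : ℂ)] at ht
        have h2 := mul_left_cancel₀ hpi ht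
        rw [div_eq_iff hNC] at h2
        have h3 : (m : ℤ) - n = t * N := by exact_mod_cast h2
        have h4 : (m : ℤ) - n = 0 :=
          Int.eq_zero_of_abs_lt_dvd (m := (N : ℤ)) ⟨t, by rw [h3, mul_comm]⟩
            (by rw [abs_lt]; constructor <;> omega)
        omega
      rw [geom_sum_eq hne, hpow, sub_self, zero_div]
  have key : ((∑ k ∈ Finset.range N, ‖∑ n ∈ S,
      Complex.exp ((-2) * (Real.pi : ℂ) * Complex.I * (k : ℂ) * (n : ℂ) / (N : ℂ))‖ ^ 2 : ℝ) : ℂ)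
      = (N : ℂ) * (S.card : ℂ) := by
    push_cast
    simp_rw [← Complex.mul_conj', map_sum, Finset.sum_mul_sum, hterm]
    rw [Finset.sum_comm]
    calc ∑ n ∈ S, ∑ k ∈ Finset.range N, ∑ m ∈ S, w n m ^ k
        = ∑ n ∈ S, ∑ m ∈ S, if n = m then (N : ℂ) else 0 := by
          refine Finset.sum_congr rfl fun n hn => ?_
          rw [Finset.sum_comm]
          exact Finset.sum_congr rfl fun m hm => hgeom n hn m hm
      _ = ∑ n ∈ S, (N : ℂ) := by
          refine Finset.sum_congr rfl fun n hn => ?_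
          rw [Finset.sum_ite_eq, if_pos hn]
      _ = _ := by rw [Finset.sum_const, nsmul_eq_mul, mul_comm]
  exact_mod_cast key

lemma sum_rpow_neg_two_thirds_le (n : ℕ) :
    ∑ k ∈ Finset.range n, ((k + 1 : ℕ) : ℝ) ^ (-(2 / 3) : ℝ) ≤ 3 * (n : ℝ) ^ (1 / 3 : ℝ) := by
  induction n with
  | zero => simp
  | succ n ih =>
    rw [Finset.sum_range_succ]
    set x : ℝ := ((n + 1 : ℕ) : ℝ) ^ (1 / 3 : ℝ) with hx
    set y : ℝ := (n : ℝ) ^ (1 / 3 : ℝ) with hy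
    have hx0 : 0 < x := by positivity
    have hy0 : 0 ≤ y := by positivity
    have hx3 : x ^ 3 = n + 1 := by
      rw [hx, ← Real.rpow_natCast, ← Real.rpow_mul (by positivity)]
      norm_num
    have hy3 : y ^ 3 = n := by
      rw [hy, ← Real.rpow_natCast, ← Real.rpow_mul (by positivity)]
      norm_num
    have hyx : y ≤ x := by
      rw [hx, hy]
      gcongr
      simp
    have hz : ((n + 1 : ℕ) : ℝ) ^ (-(2 / 3) : ℝ) = (x ^ 2)⁻¹ := by
      rw [hx, ← Real.rpow_natCast, ← Real.rpow_mul (by positivity), ← Real.rpow_neg (by positivity)]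
      norm_num
    have hstep : (x ^ 2)⁻¹ ≤ 3 * (x - y) := by
      rw [inv_le_iff_one_le_mul₀ (by positivity)]
      have hdiff : (x - y) * (x ^ 2 + x * y + y ^ 2) = 1 := by linear_combination hx3 - hy3
      have hle : x ^ 2 + x * y + y ^ 2 ≤ 3 * x ^ 2 := by nlinarith
      nlinarith [mul_le_mul_of_nonneg_left hle (sub_nonneg.2 hyx)]
    rw [hz]
    linarith

open Classical in
lemma cardBelow_eq_card_filter (A : Set ℕ) (n : ℕ) :
    cardBelow A n = ((Finset.range n).filter (· ∈ A)).card := by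
  rw [cardBelow, Nat.card_coe_set_eq, ← Set.ncard_coe_finset]
  congr 1
  ext x
  simp [and_comm]

/-- If the nontrivial Fourier coefficients of `A ∩ [0, N)` are bounded by `C (kN)^{-β/2}` with
`β > 2/3`, then `|A ∩ [0, N)|` is either comparable to `N` or at most of order `N^{4/3 - β}`. -/
lemma card_mul_sub_card_le {A : Set ℕ} {C β : ℝ} (hC : 0 < C) (hβ : 2 / 3 < β) {N : ℕ}
    (hN : 0 < N)
    (hF : ∀ k : ℕ, 1 ≤ k → k ≤ N - 1 →
      ‖dft A N k‖ ≤ C * (((k : ℝ) * (N : ℝ)) ^ (-(β / 2)))) :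
    (cardBelow A N : ℝ) * (N - cardBelow A N) ≤ 3 * C ^ 2 * (N : ℝ) ^ (4 / 3 - β) * N := by
  classical
  set S := (Finset.range N).filter (· ∈ A) with hS
  have hNR : (0 : ℝ) < N := by exact_mod_cast hN
  have hNC : (N : ℂ) ≠ 0 := by exact_mod_cast hN.ne'
  have hcard : cardBelow A N = S.card := by rw [cardBelow_eq_card_filter]
  set F : ℕ → ℂ := fun k => ∑ n ∈ S,
    Complex.exp ((-2) * (Real.pi : ℂ) * Complex.I * (k : ℂ) * (n : ℂ) / (N : ℂ)) with hFdef
  have hpars : ∑ k ∈ Finset.range N, ‖F k‖ ^ 2 = (N : ℝ) * S.card :=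
    sum_sq_norm_exp_sum hN S (Finset.filter_subset _ _)
  have hdft : ∀ k, F k = N * dft A N k := by
    intro k
    rw [dft, mul_inv_cancel_left₀ hNC]
    simp only [hFdef, hS, Finset.sum_filter]
  have hF0 : F 0 = S.card := by simp [hFdef]
  obtain ⟨M, rfl⟩ : ∃ M, N = M + 1 := ⟨N - 1, by omega⟩
  have hbound : ∀ k ∈ Finset.range M, ‖F (k + 1)‖ ^ 2 ≤
      C ^ 2 * ((M + 1 : ℕ) : ℝ) ^ (2 - β) * ((k + 1 : ℕ) : ℝ) ^ (-(2 / 3) : ℝ) := by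
    intro k hk
    have hk' := Finset.mem_range.1 hk
    have hb := hF (k + 1) (by omega) (by omega)
    rw [hdft, norm_mul, Complex.norm_natCast, mul_pow]
    have hsq : (((k + 1 : ℕ) : ℝ) * ((M + 1 : ℕ) : ℝ)) ^ (-(β / 2)) =
        (((k + 1 : ℕ) : ℝ) ^ (-(β / 2))) * (((M + 1 : ℕ) : ℝ) ^ (-(β / 2))) :=
      Real.mul_rpow (by positivity) (by positivity)
    have hpow : ∀ x : ℝ, 0 < x → (x ^ (-(β / 2))) ^ 2 = x ^ (-β) := by
      intro x hx
      rw [← Real.rpow_natCast, ← Real.rpow_mul hx.le]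
      congr 1
      push_cast
      ring
    have hk2 : ((k + 1 : ℕ) : ℝ) ^ (-β) ≤ ((k + 1 : ℕ) : ℝ) ^ (-(2 / 3) : ℝ) := by
      apply Real.rpow_le_rpow_of_exponent_le
      · simp
      · linarith
    have hN2 : ((M + 1 : ℕ) : ℝ) ^ (2 - β) =
        ((M + 1 : ℕ) : ℝ) ^ 2 * ((M + 1 : ℕ) : ℝ) ^ (-β) := by
      rw [← Real.rpow_natCast, ← Real.rpow_add hNR]
      congr 1
    calc ((M + 1 : ℕ) : ℝ) ^ 2 * ‖dft A (M + 1) (k + 1)‖ ^ 2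
        ≤ ((M + 1 : ℕ) : ℝ) ^ 2 *
          (C * (((k + 1 : ℕ) : ℝ) * ((M + 1 : ℕ) : ℝ)) ^ (-(β / 2))) ^ 2 := by gcongr
      _ = C ^ 2 * ((M + 1 : ℕ) : ℝ) ^ (2 - β) * ((k + 1 : ℕ) : ℝ) ^ (-β) := by
          rw [hsq, mul_pow, mul_pow, hpow _ (by positivity), hpow _ (by positivity), hN2]
          ring
      _ ≤ _ := by gcongr
  have hsum := Finset.sum_le_sum hbound
  rw [← Finset.mul_sum] at hsum
  have hpars' : ∑ k ∈ Finset.range M, ‖F (k + 1)‖ ^ 2 + (S.card : ℝ) ^ 2 =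
      ((M + 1 : ℕ) : ℝ) * S.card := by
    rw [← hpars, Finset.sum_range_succ', hF0, Complex.norm_natCast]
  have hM : (M : ℝ) ^ (1 / 3 : ℝ) ≤ ((M + 1 : ℕ) : ℝ) ^ (1 / 3 : ℝ) := by
    gcongr
    simp
  have hexp : ((M + 1 : ℕ) : ℝ) ^ (2 - β) * ((M + 1 : ℕ) : ℝ) ^ (1 / 3 : ℝ) =
      ((M + 1 : ℕ) : ℝ) ^ (4 / 3 - β) * ((M + 1 : ℕ) : ℝ) := by
    rw [← Real.rpow_add hNR, ← Real.rpow_add_one hNR.ne']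
    congr 1
    ring
  have htail : ∑ k ∈ Finset.range M, ‖F (k + 1)‖ ^ 2 ≤
      3 * C ^ 2 * ((M + 1 : ℕ) : ℝ) ^ (4 / 3 - β) * ((M + 1 : ℕ) : ℝ) := by
    calc _ ≤ _ := hsum
      _ ≤ C ^ 2 * ((M + 1 : ℕ) : ℝ) ^ (2 - β) * (3 * ((M + 1 : ℕ) : ℝ) ^ (1 / 3 : ℝ)) := by
          gcongr
          exact (sum_rpow_neg_two_thirds_le M).trans (by gcongr)
      _ = _ := by linear_combination 3 * C ^ 2 * hexp
  rw [hcard]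
  linarith

/-- If `A ⊆ ℕ` has upper fractional density `α > 1/2` and, for some `C > 0` and
`2/3 < β ≤ 1` with `β > 2 − 2α`, the discrete Fourier coefficients satisfy
`|χ̂_{A_N}(k)| ≤ C (kN)^{−β/2}` for all large `N` and all `1 ≤ k ≤ N − 1`, then `A`
contains a non-trivial arithmetic progression of length 3. -/
theorem statement1 (A : Set ℕ) (α : ℝ) (hα : 1 / 2 < α)
    (hdens : HasUpperFracDensity A α)
    (C β : ℝ) (hC : 0 < C) (hβ1 : 2 / 3 < β) (hβ2 : β ≤ 1) (hβ3 : 2 - 2 * α < β)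
    (N0 : ℕ)
    (hF : ∀ N : ℕ, N0 ≤ N → ∀ k : ℕ, 1 ≤ k → k ≤ N - 1 →
      ‖dft A N k‖ ≤ C * (((k : ℝ) * (N : ℝ)) ^ (-(β / 2)))) :
    ∃ a d : ℕ, 1 ≤ d ∧ a ∈ A ∧ a + d ∈ A ∧ a + 2 * d ∈ A := by
  classical
  have hb : 4 / 3 - β < α := by linarith
  have hfreq : ∃ᶠ n : ℕ in atTop, ENNReal.ofReal (6 * C ^ 2) <
      (cardBelow A n : ℝ≥0∞) / (n : ℝ≥0∞) ^ (4 / 3 - β) := by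
    refine frequently_lt_of_lt_limsup (h := ?_)
    rw [hdens.1 _ hb]
    exact ENNReal.ofReal_lt_top
  obtain ⟨N, hlt, hN⟩ := (hfreq.and_eventually
    (eventually_ge_atTop (max (max N0 1) (cornersTheoremBound ((1 / 2) / 3))))).exists
  have hN0 : N0 ≤ N := by omega
  have hN1 : 0 < N := by omega
  have hNR : (0 : ℝ) < N := by exact_mod_cast hN1
  have hP : (0 : ℝ) < (N : ℝ) ^ (4 / 3 - β) := by positivity
  have hc : 6 * C ^ 2 * (N : ℝ) ^ (4 / 3 - β) < cardBelow A N := by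
    rw [← ENNReal.ofReal_natCast N, ENNReal.ofReal_rpow_of_pos hNR,
      ← ENNReal.ofReal_natCast (cardBelow A N), ← ENNReal.ofReal_div_of_pos hP] at hlt
    exact (lt_div_iff₀ hP).1 (ENNReal.ofReal_lt_ofReal_iff'.1 hlt).1
  have hmain := card_mul_sub_card_le hC hβ1 hN1 (hF N hN0)
  have hc0 : (0 : ℝ) < cardBelow A N := lt_of_le_of_lt (by positivity) hc
  have hdense : (1 / 2 : ℝ) * N ≤ cardBelow A N := by
    have : (cardBelow A N : ℝ) * (N - cardBelow A N) ≤ cardBelow A N * (N / 2) := by nlinarith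
    linarith [le_of_mul_le_mul_left this hc0]
  rw [cardBelow_eq_card_filter] at hdense
  have hroth := roth_3ap_theorem_nat (1 / 2) (by norm_num) (by omega) _
    (Finset.filter_subset _ _) hdense
  simp only [ThreeAPFree, not_forall] at hroth
  obtain ⟨a, ha, b, hb, c, hc, habc, hne⟩ := hroth
  have ha' := (Finset.mem_filter.1 (Finset.mem_coe.1 ha)).2
  have hb' := (Finset.mem_filter.1 (Finset.mem_coe.1 hb)).2
  have hc' := (Finset.mem_filter.1 (Finset.mem_coe.1 hc)).2
  rcases lt_or_gt_of_ne hne with h | h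
  · refine ⟨a, b - a, by omega, ha', ?_, ?_⟩
    · rwa [show a + (b - a) = b by omega]
    · rwa [show a + 2 * (b - a) = c by omega]
  · refine ⟨c, b - c, by omega, hc', ?_, ?_⟩
    · rwa [show c + (b - c) = b by omega]
    · rwa [show c + 2 * (b - c) = a by omega]
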